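/- Let γ ∈ ℝ and let U : ℝ → ℝ be a measurable, 2π-periodic, essentially bounded function with ∫₀^{2π} U = 0 and ess sup U < γ. For a 2π-periodic essentially bounded zero-mean function u, define S_γ(u) = ∫₀^{2π} [ (∂⁻¹u)(z)² + (1/3)·u(z)³ − γ·u(z)² ] dz, where ∂⁻¹u is the 2π-periodic absolutely continuous function with derivative u almost everywhere and with ∫₀^{2π} ∂⁻¹u = 0. Then the following are equivalent: (i) U agrees almost everywhere with a smooth 2π-periodic function Ũ satisfying ((γ − Ũ(z))·Ũ'(z))' + Ũ(z) = 0 for all z ∈ ℝ; (ii) for every smooth 2π-periodic function v : ℝ → ℝ with ∫₀^{2π} v = 0, the map t ↦ S_γ(U + t·v) is differentiable at t = 0 with derivative equal to 0. -/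

import Mathlib

open Real MeasureTheory

/-- The zero-mean antiderivative of a zero-mean `2π`-periodic function:
the primitive `z ↦ ∫₀^z u`, shifted so that its mean over `[0, 2π]` is zero. -/
noncomputable def zeroMeanAntideriv (u : ℝ → ℝ) : ℝ → ℝ :=
  fun z => (∫ t in (0:ℝ)..z, u t)
    - (1 / (2 * π)) * ∫ t in (0:ℝ)..(2 * π), (∫ s in (0:ℝ)..t, u s)

/-- The energy–momentum functional `S_γ(u) = ∫₀^{2π} [(∂⁻¹u)² + (1/3)u³ − γ u²]`. -/
noncomputable def Sfun (γ : ℝ) (u : ℝ → ℝ) : ℝ :=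
  ∫ z in (0:ℝ)..(2 * π),
    ((zeroMeanAntideriv u z) ^ 2 + (1/3) * (u z) ^ 3 - γ * (u z) ^ 2)

theorem zeroMeanAntideriv_continuous {f : ℝ → ℝ} (hf : ∀ a b, IntervalIntegrable f volume a b) :
    Continuous (zeroMeanAntideriv f) :=
  (intervalIntegral.continuous_primitive hf 0).sub continuous_const

theorem zeroMeanAntideriv_hasDerivAt {f : ℝ → ℝ} (hf : Continuous f) (z : ℝ) :
    HasDerivAt (zeroMeanAntideriv f) (f z) z :=
  (intervalIntegral.integral_hasDerivAt_right (hf.intervalIntegrable _ _)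
    (hf.stronglyMeasurableAtFilter _ _) hf.continuousAt).sub_const _

theorem zeroMeanAntideriv_add_mul {f g : ℝ → ℝ} (hf : ∀ a b, IntervalIntegrable f volume a b)
    (hg : ∀ a b, IntervalIntegrable g volume a b) (t z : ℝ) :
    zeroMeanAntideriv (fun x => f x + t * g x) z =
      zeroMeanAntideriv f z + t * zeroMeanAntideriv g z := by
  have h (w : ℝ) : (∫ x in (0:ℝ)..w, (f x + t * g x)) =
      (∫ x in (0:ℝ)..w, f x) + t * ∫ x in (0:ℝ)..w, g x := by
    rw [intervalIntegral.integral_add (hf _ _) ((hg _ _).const_mul t),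
      intervalIntegral.integral_const_mul]
  have hF := intervalIntegral.continuous_primitive hf 0
  have hG := intervalIntegral.continuous_primitive hg 0
  simp only [zeroMeanAntideriv, h]
  rw [intervalIntegral.integral_add (hF.intervalIntegrable _ _)
    ((hG.intervalIntegrable _ _).const_mul t), intervalIntegral.integral_const_mul]
  ring

theorem zeroMeanAntideriv_integral {f : ℝ → ℝ} (hf : ∀ a b, IntervalIntegrable f volume a b) :
    (∫ z in (0:ℝ)..(2 * π), zeroMeanAntideriv f z) = 0 := by
  have hF := intervalIntegral.continuous_primitive hf 0
  simp only [zeroMeanAntideriv]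
  rw [intervalIntegral.integral_sub (hF.intervalIntegrable _ _) (by simp),
    intervalIntegral.integral_const, smul_eq_mul]
  field_simp
  ring

theorem zeroMeanAntideriv_periodic {f : ℝ → ℝ} (hf : ∀ a b, IntervalIntegrable f volume a b)
    (hper : Function.Periodic f (2 * π)) (hmean : (∫ z in (0:ℝ)..(2 * π), f z) = 0) :
    Function.Periodic (zeroMeanAntideriv f) (2 * π) := by
  intro z
  have h : (∫ x in z..(z + 2 * π), f x) = 0 := by
    rw [hper.intervalIntegral_add_eq z 0, zero_add, hmean]
  simp only [zeroMeanAntideriv]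
  rw [← intervalIntegral.integral_add_adjacent_intervals (hf 0 z) (hf z (z + 2 * π)), h, add_zero]

theorem zeroMeanAntideriv_congr_ae {f g : ℝ → ℝ} (h : f =ᵐ[volume] g) :
    zeroMeanAntideriv f = zeroMeanAntideriv g := by
  have h' (w : ℝ) : (∫ x in (0:ℝ)..w, f x) = ∫ x in (0:ℝ)..w, g x :=
    intervalIntegral.integral_congr_ae (h.mono fun x hx _ => hx)
  funext z
  simp only [zeroMeanAntideriv, h']

theorem contDiff_zeroMeanAntideriv {f : ℝ → ℝ} {n : ℕ} (hf : ContDiff ℝ n f) :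
    ContDiff ℝ (n + 1 : ℕ) (zeroMeanAntideriv f) := by
  have hd := zeroMeanAntideriv_hasDerivAt hf.continuous
  push_cast
  refine contDiff_succ_iff_deriv.2 ⟨fun z => (hd z).differentiableAt, by simp, ?_⟩
  rwa [funext fun z => (hd z).deriv]

theorem intervalIntegrable_of_ae_bounded {f : ℝ → ℝ} (hf : Measurable f) {M : ℝ}
    (hM : ∀ᵐ z ∂(volume : Measure ℝ), |f z| ≤ M) (a b : ℝ) :
    IntervalIntegrable f volume a b := by
  refine (intervalIntegrable_const (c := M)).mono_fun hf.aestronglyMeasurable ?_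
  refine ae_restrict_of_ae (hM.mono fun x hx => ?_)
  exact hx.trans (le_abs_self M)

/-- The `L²` gradient `u² − 2γu − 2∂⁻²u` of `Sfun γ`. -/
noncomputable def gradSfun (γ : ℝ) (u : ℝ → ℝ) : ℝ → ℝ :=
  fun z => u z ^ 2 - 2 * γ * u z - 2 * zeroMeanAntideriv (zeroMeanAntideriv u) z

theorem gradSfun_intervalIntegrable {u : ℝ → ℝ} (γ : ℝ)
    (hu1 : ∀ a b, IntervalIntegrable u volume a b)
    (hu2 : ∀ a b, IntervalIntegrable (fun z => u z ^ 2) volume a b) (a b : ℝ) :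
    IntervalIntegrable (gradSfun γ u) volume a b := by
  have hA := zeroMeanAntideriv_continuous hu1
  have hW := zeroMeanAntideriv_continuous fun a b => hA.intervalIntegrable a b
  exact ((hu2 a b).sub ((hu1 a b).const_mul _)).sub ((hW.intervalIntegrable a b).const_mul 2)

theorem integral_zeroMeanAntideriv_mul {u v : ℝ → ℝ}
    (hu : ∀ a b, IntervalIntegrable u volume a b) (hv : Continuous v)
    (hvper : Function.Periodic v (2 * π)) (hvmean : (∫ z in (0:ℝ)..(2 * π), v z) = 0) :
    (∫ z in (0:ℝ)..(2 * π), zeroMeanAntideriv u z * zeroMeanAntideriv v z) =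
      -∫ z in (0:ℝ)..(2 * π), zeroMeanAntideriv (zeroMeanAntideriv u) z * v z := by
  have hA := zeroMeanAntideriv_continuous hu
  have hAv := zeroMeanAntideriv_continuous fun a b => hv.intervalIntegrable a b
  have hW : zeroMeanAntideriv (zeroMeanAntideriv u) (2 * π) =
      zeroMeanAntideriv (zeroMeanAntideriv u) 0 := by
    simp only [zeroMeanAntideriv.eq_1 (zeroMeanAntideriv u)]
    rw [zeroMeanAntideriv_integral hu, intervalIntegral.integral_same]
  have hAvP := zeroMeanAntideriv_periodic (fun a b => hv.intervalIntegrable a b) hvper hvmean 0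
  rw [zero_add] at hAvP
  have := intervalIntegral.integral_mul_deriv_eq_deriv_mul (a := 0) (b := 2 * π)
    (fun x _ => zeroMeanAntideriv_hasDerivAt hA x) (fun x _ => zeroMeanAntideriv_hasDerivAt hv x)
    (hA.intervalIntegrable _ _) (hv.intervalIntegrable _ _)
  rw [hW, hAvP] at this
  linarith

theorem hasDerivAt_Sfun {u v : ℝ → ℝ} (γ : ℝ) (hu1 : ∀ a b, IntervalIntegrable u volume a b)
    (hu2 : ∀ a b, IntervalIntegrable (fun z => u z ^ 2) volume a b)
    (hu3 : ∀ a b, IntervalIntegrable (fun z => u z ^ 3) volume a b) (hv : Continuous v)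
    (hvper : Function.Periodic v (2 * π)) (hvmean : (∫ z in (0:ℝ)..(2 * π), v z) = 0) :
    HasDerivAt (fun t : ℝ => Sfun γ (fun z => u z + t * v z))
      (∫ z in (0:ℝ)..(2 * π), gradSfun γ u z * v z) 0 := by
  have hvi (a b : ℝ) := hv.intervalIntegrable (μ := volume) a b
  have hA := zeroMeanAntideriv_continuous hu1
  have hAv := zeroMeanAntideriv_continuous hvi
  set A := zeroMeanAntideriv u with hAdef
  set B := zeroMeanAntideriv v with hBdef
  have hW := zeroMeanAntideriv_continuous fun a b => hA.intervalIntegrable a b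
  have i0 : IntervalIntegrable (fun z => A z ^ 2 + (1/3) * u z ^ 3 - γ * u z ^ 2) volume
      0 (2 * π) :=
    (((hA.pow 2).intervalIntegrable _ _).add ((hu3 _ _).const_mul _)).sub ((hu2 _ _).const_mul _)
  have ig : IntervalIntegrable (fun z => (u z ^ 2 - 2 * γ * u z) * v z) volume 0 (2 * π) :=
    ((hu2 _ _).sub ((hu1 _ _).const_mul _)).mul_continuousOn hv.continuousOn
  have iAB : IntervalIntegrable (fun z => 2 * (A z * B z)) volume 0 (2 * π) :=
    ((hA.mul hAv).intervalIntegrable _ _).const_mul 2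
  have i1 := iAB.add ig
  have i2 : IntervalIntegrable (fun z => B z ^ 2 + u z * v z ^ 2 - γ * v z ^ 2) volume 0 (2 * π) :=
    (((hAv.pow 2).intervalIntegrable _ _).add
      ((hu1 _ _).mul_continuousOn (hv.pow 2).continuousOn)).sub
      (((hv.pow 2).intervalIntegrable _ _).const_mul _)
  have i3 : IntervalIntegrable (fun z => (1/3) * v z ^ 3) volume 0 (2 * π) :=
    ((hv.pow 3).intervalIntegrable _ _).const_mul _
  have hgrad : (∫ z in (0:ℝ)..(2 * π), gradSfun γ u z * v z) =
      ∫ z in (0:ℝ)..(2 * π), (2 * (A z * B z) + (u z ^ 2 - 2 * γ * u z) * v z) := by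
    rw [intervalIntegral.integral_add iAB ig, intervalIntegral.integral_const_mul,
      integral_zeroMeanAntideriv_mul hu1 hv hvper hvmean, ← hAdef]
    have : (fun z => gradSfun γ u z * v z) = fun z =>
        (u z ^ 2 - 2 * γ * u z) * v z - 2 * (zeroMeanAntideriv A z * v z) := by
      funext z
      simp only [gradSfun, ← hAdef]
      ring
    have iW : IntervalIntegrable (fun z => 2 * (zeroMeanAntideriv A z * v z)) volume 0 (2 * π) :=
      ((hW.mul hv).intervalIntegrable _ _).const_mul 2
    rw [this, intervalIntegral.integral_sub ig iW, intervalIntegral.integral_const_mul]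
    ring
  rw [hgrad]
  have hS : (fun t : ℝ => Sfun γ (fun z => u z + t * v z)) = fun t : ℝ =>
      (∫ z in (0:ℝ)..(2 * π), (A z ^ 2 + (1/3) * u z ^ 3 - γ * u z ^ 2))
      + t * (∫ z in (0:ℝ)..(2 * π), (2 * (A z * B z) + (u z ^ 2 - 2 * γ * u z) * v z))
      + t ^ 2 * (∫ z in (0:ℝ)..(2 * π), (B z ^ 2 + u z * v z ^ 2 - γ * v z ^ 2))
      + t ^ 3 * (∫ z in (0:ℝ)..(2 * π), (1/3) * v z ^ 3) := by
    funext t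
    rw [← intervalIntegral.integral_const_mul, ← intervalIntegral.integral_const_mul,
      ← intervalIntegral.integral_const_mul, ← intervalIntegral.integral_add i0 (i1.const_mul t),
      ← intervalIntegral.integral_add (i0.add (i1.const_mul t)) (i2.const_mul _),
      ← intervalIntegral.integral_add ((i0.add (i1.const_mul t)).add (i2.const_mul _))
        (i3.const_mul _)]
    refine intervalIntegral.integral_congr fun z _ => ?_
    simp only [zeroMeanAntideriv_add_mul hu1 hvi, ← hAdef, ← hBdef]
    ring
  rw [hS]
  generalize (∫ z in (0:ℝ)..(2 * π), (2 * (A z * B z) + (u z ^ 2 - 2 * γ * u z) * v z)) = c1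
  have ht := hasDerivAt_id (0:ℝ)
  refine ((((ht.mul_const c1).const_add _).add ((ht.pow 2).mul_const _)).add
    ((ht.pow 3).mul_const _)).congr_deriv ?_
  simp

theorem exists_contDiff_periodic_extension {g : ℝ → ℝ} {n : WithTop ℕ∞} {P : ℝ} (hP : 0 < P)
    (hg : ContDiff ℝ n g) (hsupp : ∀ x, x ∉ Set.Ioo 0 P → g x = 0) :
    ∃ v : ℝ → ℝ, ContDiff ℝ n v ∧ Function.Periodic v P ∧ ∀ x ∈ Set.Ico 0 P, v x = g x := by
  refine ⟨fun x => g (x - P * ⌊x / P⌋), ?_, ?_, ?_⟩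
  · rw [contDiff_iff_contDiffAt]
    intro x₀
    set k : ℤ := round (x₀ / P)
    have hk := abs_le.1 (abs_sub_round (x₀ / P))
    have hx₀ : x₀ / P ∈ Set.Ioo ((k : ℝ) - 1) (k + 1) :=
      ⟨by linarith [hk.1], by linarith [hk.2]⟩
    have hnhds : ∀ᶠ x in nhds x₀, x / P ∈ Set.Ioo ((k : ℝ) - 1) (k + 1) :=
      (continuous_id.div_const P).continuousAt.eventually_mem (isOpen_Ioo.mem_nhds hx₀)
    have hsum : ContDiff ℝ n fun x => g (x - P * k) + g (x - P * (k - 1)) :=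
      (hg.comp (contDiff_id.sub contDiff_const)).add (hg.comp (contDiff_id.sub contDiff_const))
    refine hsum.contDiffAt.congr_of_eventuallyEq (hnhds.mono fun x hx => ?_)
    have h1 : P * (k - 1) < x := by
      have := (lt_div_iff₀ hP).1 hx.1
      linarith
    rcases lt_or_ge (x / P) k with h | h
    · have hfl : ⌊x / P⌋ = k - 1 := by
        rw [Int.floor_eq_iff]
        push_cast
        exact ⟨hx.1.le, by linarith⟩
      have hxk := (div_lt_iff₀ hP).1 h
      have h0 : g (x - P * k) = 0 := hsupp _ fun hmem => by linarith [hmem.1]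
      simp [hfl, h0]
    · have hfl : ⌊x / P⌋ = k := Int.floor_eq_iff.2 ⟨h, hx.2⟩
      have hxk := (le_div_iff₀ hP).1 h
      have h0 : g (x - P * (k - 1)) = 0 := hsupp _ fun hmem => by linarith [hmem.2]
      simp [hfl, h0]
  · intro x
    have : (x + P) / P = x / P + 1 := by field_simp
    simp only [this, Int.floor_add_one]
    congr 1
    push_cast
    ring
  · intro x hx
    have : ⌊x / P⌋ = 0 := by
      rw [Int.floor_eq_iff]
      push_cast
      exact ⟨div_nonneg hx.1 hP.le, by rw [div_lt_iff₀ hP]; linarith [hx.2]⟩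
    simp [this]

theorem ae_of_periodic_of_ae_Ioo {p : ℝ → Prop} {P : ℝ} (hP : 0 < P)
    (hper : Function.Periodic p P)
    (h : ∀ᵐ x ∂(volume : Measure ℝ), x ∈ Set.Ioo 0 P → p x) :
    ∀ᵐ x ∂(volume : Measure ℝ), p x := by
  have hshift : ∀ k : ℤ, ∀ᵐ x ∂(volume : Measure ℝ), x - k * P ∈ Set.Ioo 0 P → p (x - k * P) :=
    fun k => (measurePreserving_sub_right volume ((k : ℝ) * P)).quasiMeasurePreserving.ae h
  have hne : ∀ k : ℤ, ∀ᵐ x ∂(volume : Measure ℝ), x ≠ k * P := fun k =>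
    Measure.ae_ne volume _
  filter_upwards [ae_all_iff.2 hshift, ae_all_iff.2 hne] with x hx hx'
  have h1 := (le_div_iff₀ hP).1 (Int.floor_le (x / P))
  have h2 := (div_lt_iff₀ hP).1 (Int.lt_floor_add_one (x / P))
  have h3 := hx ⌊x / P⌋ ⟨sub_pos.2 (lt_of_le_of_ne h1 (hx' _).symm), by linarith⟩
  rwa [hper.sub_int_mul_eq] at h3

/-- The periodic du Bois-Reymond lemma. -/
theorem exists_ae_eq_const_of_integral_mul_periodic_eq_zero {F : ℝ → ℝ} {P : ℝ} (hP : 0 < P)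
    (hF : IntervalIntegrable F volume 0 P)
    (h : ∀ v : ℝ → ℝ, ContDiff ℝ (⊤ : ℕ∞) v → Function.Periodic v P →
      (∫ z in (0:ℝ)..P, v z) = 0 → (∫ z in (0:ℝ)..P, F z * v z) = 0) :
    ∃ c : ℝ, ∀ᵐ x ∂(volume : Measure ℝ), x ∈ Set.Ioo 0 P → F x = c := by
  set c : ℝ := (1 / P) * ∫ z in (0:ℝ)..P, F z with hc
  refine ⟨c, ?_⟩
  have hFc : IntervalIntegrable (fun x => F x - c) volume 0 P := hF.sub (by simp)
  have hloc : LocallyIntegrableOn (fun x => F x - c) (Set.Ioo 0 P) volume :=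
    (((intervalIntegrable_iff_integrableOn_Ioc_of_le hP.le).1 hFc).mono_set
      Set.Ioo_subset_Ioc_self).locallyIntegrableOn
  refine (isOpen_Ioo.ae_eq_zero_of_integral_contDiff_smul_eq_zero hloc ?_).mono
    fun x hx hmem => sub_eq_zero.1 (hx hmem)
  intro g hg _ hsupp
  have hg0 : ∀ x, x ∉ Set.Ioo 0 P → g x = 0 := fun x hx =>
    image_eq_zero_of_notMem_tsupport fun hmem => hx (hsupp hmem)
  obtain ⟨v, hv, hvper, hvg⟩ := exists_contDiff_periodic_extension hP hg hg0
  have hvg' : ∀ x ∈ Set.uIcc 0 P, v x = g x := by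
    rw [Set.uIcc_of_le hP.le]
    rintro x ⟨hx0, hxP⟩
    rcases hxP.lt_or_eq with hlt | rfl
    · exact hvg x ⟨hx0, hlt⟩
    · have := hvper 0
      rw [zero_add] at this
      rw [this, hvg 0 ⟨le_rfl, hP⟩, hg0 0 (by simp), hg0 x (by simp)]
  have hintegral (φ : ℝ → ℝ) (hφ : ∀ x, x ∉ Set.Ioo 0 P → φ x = 0) :
      ∫ x, φ x = ∫ x in (0:ℝ)..P, φ x := by
    rw [intervalIntegral.integral_of_le hP.le]
    refine (setIntegral_eq_integral_of_forall_compl_eq_zero fun x hx => hφ x fun hmem => ?_).symm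
    exact hx (Set.Ioo_subset_Ioc_self hmem)
  rw [hintegral _ fun x hx => by simp [hg0 x hx]]
  set m : ℝ := (1 / P) * ∫ z in (0:ℝ)..P, g z with hm
  have hgi : IntervalIntegrable g volume 0 P := hg.continuous.intervalIntegrable _ _
  have hFg : IntervalIntegrable (fun z => F z * g z) volume 0 P :=
    hF.mul_continuousOn hg.continuous.continuousOn
  have hvm : (∫ z in (0:ℝ)..P, (v z - m)) = 0 := by
    rw [intervalIntegral.integral_congr (g := fun z => g z - m) fun x hx => by
      simp only [hvg' x hx], intervalIntegral.integral_sub hgi (by simp),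
      intervalIntegral.integral_const, smul_eq_mul, hm]
    field_simp
    ring
  have hcrit := h (fun z => v z - m) (hv.sub contDiff_const)
    (fun z => by simp only [hvper z]) hvm
  rw [intervalIntegral.integral_congr (g := fun z => F z * g z - F z * m) fun x hx => by
    simp only [hvg' x hx]; ring, intervalIntegral.integral_sub hFg (hF.mul_const m),
    intervalIntegral.integral_mul_const] at hcrit
  rw [intervalIntegral.integral_congr (g := fun z => F z * g z - c * g z) fun x _ => by
    simp only [smul_eq_mul]; ring, intervalIntegral.integral_sub hFg (hgi.const_mul c),
    intervalIntegral.integral_const_mul]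
  refine Eq.trans ?_ hcrit
  rw [hc, hm]
  ring

theorem gradSfun_eq_const_of_ode {γ : ℝ} {V : ℝ → ℝ} (hV : ContDiff ℝ (⊤ : ℕ∞) V)
    (hper : Function.Periodic V (2 * π)) (hmean : (∫ z in (0:ℝ)..(2 * π), V z) = 0)
    (hode : ∀ z : ℝ, deriv (fun w => (γ - V w) * deriv V w) z + V z = 0) :
    ∃ c : ℝ, ∀ z, gradSfun γ V z = c := by
  have hVi (a b : ℝ) := hV.continuous.intervalIntegrable (μ := volume) a b
  have hA := zeroMeanAntideriv_continuous hVi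
  have hAi (a b : ℝ) := hA.intervalIntegrable (μ := volume) a b
  have hVd : Differentiable ℝ V := hV.differentiable (by simp)
  have hV'd : Differentiable ℝ (deriv V) :=
    ((contDiff_infty_iff_deriv.1 hV).2).differentiable (by simp)
  have hd1 (z : ℝ) : HasDerivAt (gradSfun γ V)
      (-2 * ((γ - V z) * deriv V z) - 2 * zeroMeanAntideriv V z) z := by
    have h := (hVd z).hasDerivAt
    refine (((h.fun_pow 2).sub (h.const_mul (2 * γ))).sub
      ((zeroMeanAntideriv_hasDerivAt hA z).const_mul 2)).congr_deriv ?_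
    push_cast
    ring
  have hd2 (z : ℝ) : HasDerivAt
      (fun z => -2 * ((γ - V z) * deriv V z) - 2 * zeroMeanAntideriv V z) 0 z := by
    have h : DifferentiableAt ℝ (fun w => (γ - V w) * deriv V w) z :=
      ((hVd z).const_sub γ).mul (hV'd z)
    refine ((h.hasDerivAt.const_mul (-2)).sub
      ((zeroMeanAntideriv_hasDerivAt hV.continuous z).const_mul 2)).congr_deriv ?_
    linarith [hode z]
  set k := -2 * ((γ - V 0) * deriv V 0) - 2 * zeroMeanAntideriv V 0 with hk
  have hconst (z : ℝ) : -2 * ((γ - V z) * deriv V z) - 2 * zeroMeanAntideriv V z = k :=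
    is_const_of_deriv_eq_zero (fun z => (hd2 z).differentiableAt) (fun z => (hd2 z).deriv) z 0
  have hlin (z : ℝ) : HasDerivAt (fun z => gradSfun γ V z - k * z) 0 z := by
    have h1 := hd1 z
    rw [hconst] at h1
    exact (h1.sub ((hasDerivAt_id z).const_mul k)).congr_deriv (by ring)
  have heq (z : ℝ) : gradSfun γ V z - k * z = gradSfun γ V 0 - k * 0 :=
    is_const_of_deriv_eq_zero (fun z => (hlin z).differentiableAt) (fun z => (hlin z).deriv) z 0
  have hWper := zeroMeanAntideriv_periodic hAi (zeroMeanAntideriv_periodic hVi hper hmean)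
    (zeroMeanAntideriv_integral hVi)
  have hG : gradSfun γ V (2 * π) = gradSfun γ V 0 := by
    have h1 := hper 0
    have h2 := hWper 0
    rw [zero_add] at h1 h2
    simp only [gradSfun, h1, h2]
  have hk0 : k = 0 := by
    have := heq (2 * π)
    rw [hG] at this
    have h3 : k * (2 * π) = 0 := by linarith
    exact (mul_eq_zero.1 h3).resolve_right (by positivity)
  refine ⟨gradSfun γ V 0, fun z => ?_⟩
  have := heq z
  rw [hk0] at this
  linarith

theorem contDiff_of_eq_sub_sqrt {γ c : ℝ} {V G : ℝ → ℝ} (hV : Continuous V)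
    (hG : ∀ z, G z = γ ^ 2 + c + 2 * zeroMeanAntideriv (zeroMeanAntideriv V) z)
    (hpos : ∀ z, 0 < G z) (hVG : ∀ z, V z = γ - √(G z)) : ContDiff ℝ (⊤ : ℕ∞) V := by
  refine contDiff_infty.2 fun n => ?_
  induction n with
  | zero => exact contDiff_zero.2 hV
  | succ n ih =>
    have hW := contDiff_zeroMeanAntideriv (contDiff_zeroMeanAntideriv ih)
    have hGn : ContDiff ℝ (n + 1 + 1 : ℕ) G := by
      rw [funext hG]
      exact contDiff_const.add (contDiff_const.mul hW)
    rw [funext hVG]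
    exact contDiff_const.sub
      ((hGn.of_le (by exact_mod_cast Nat.le_succ _)).sqrt fun z => (hpos z).ne')

theorem ode_of_eq_sub_sqrt {γ c : ℝ} {V G : ℝ → ℝ} (hV : Continuous V)
    (hG : ∀ z, G z = γ ^ 2 + c + 2 * zeroMeanAntideriv (zeroMeanAntideriv V) z)
    (hpos : ∀ z, 0 < G z) (hVG : ∀ z, V z = γ - √(G z)) (z : ℝ) :
    deriv (fun w => (γ - V w) * deriv V w) z + V z = 0 := by
  have hA : Continuous (zeroMeanAntideriv V) :=
    zeroMeanAntideriv_continuous fun a b => hV.intervalIntegrable a b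
  have hGd (w : ℝ) : HasDerivAt G (2 * zeroMeanAntideriv V w) w := by
    rw [funext hG]
    exact ((zeroMeanAntideriv_hasDerivAt hA w).const_mul 2).const_add _
  have hVd (w : ℝ) : HasDerivAt V (-(2 * zeroMeanAntideriv V w / (2 * √(G w)))) w := by
    exact (((hGd w).sqrt (hpos w).ne').const_sub γ).congr_of_eventuallyEq (.of_forall hVG)
  have hprod : (fun w => (γ - V w) * deriv V w) = fun w => -zeroMeanAntideriv V w := by
    funext w
    have : √(G w) ≠ 0 := (Real.sqrt_pos.2 (hpos w)).ne'
    rw [(hVd w).deriv, hVG w]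
    field_simp
    ring
  rw [hprod, (zeroMeanAntideriv_hasDerivAt hV z).fun_neg.deriv]
  ring

theorem Continuous.forall_le_of_ae_le {f : ℝ → ℝ} (hf : Continuous f) {a : ℝ}
    (h : ∀ᵐ z ∂(volume : Measure ℝ), a ≤ f z) (z : ℝ) : a ≤ f z := by
  have : (fun z => max a (f z)) = f :=
    (Continuous.ae_eq_iff_eq volume (continuous_const.max hf) hf).1
      (h.mono fun z hz => max_eq_right hz)
  exact max_eq_right_iff.1 (congrFun this z)

theorem critical_points_of_energy_reduced_ostrovsky
    (γ : ℝ) (U : ℝ → ℝ) (hmeas : Measurable U)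
    (hper : Function.Periodic U (2 * π))
    (hbdd : ∃ M : ℝ, ∀ᵐ z ∂(volume : Measure ℝ), |U z| ≤ M)
    (hmean : (∫ z in (0:ℝ)..(2 * π), U z) = 0)
    (hlt : ∃ δ > (0:ℝ), ∀ᵐ z ∂(volume : Measure ℝ), U z ≤ γ - δ) :
    (∃ V : ℝ → ℝ, ContDiff ℝ (⊤ : ℕ∞) V ∧ Function.Periodic V (2 * π) ∧
        (∀ z : ℝ, deriv (fun w => (γ - V w) * deriv V w) z + V z = 0) ∧
        (∀ᵐ z ∂(volume : Measure ℝ), U z = V z))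
    ↔
    (∀ v : ℝ → ℝ, ContDiff ℝ (⊤ : ℕ∞) v → Function.Periodic v (2 * π) →
        (∫ z in (0:ℝ)..(2 * π), v z) = 0 →
        HasDerivAt (fun t : ℝ => Sfun γ (fun z => U z + t * v z)) 0 0) := by
  obtain ⟨M, hM⟩ := hbdd
  obtain ⟨δ, hδ, hlt⟩ := hlt
  have hU1 := intervalIntegrable_of_ae_bounded hmeas hM
  have hUpow (n : ℕ) : ∀ a b, IntervalIntegrable (fun z => U z ^ n) volume a b :=
    intervalIntegrable_of_ae_bounded (hmeas.pow_const n) (M := M ^ n) <| hM.mono fun z hz => by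
      rw [abs_pow]
      exact pow_le_pow_left₀ (abs_nonneg _) hz n
  have hderiv (v : ℝ → ℝ) (hv : ContDiff ℝ (⊤ : ℕ∞) v) (hvper : Function.Periodic v (2 * π))
      (hvmean : (∫ z in (0:ℝ)..(2 * π), v z) = 0) :=
    hasDerivAt_Sfun γ hU1 (hUpow 2) (hUpow 3) hv.continuous hvper hvmean
  have hP : 0 < 2 * π := by positivity
  have hA := zeroMeanAntideriv_continuous hU1
  have hAi (a b : ℝ) := hA.intervalIntegrable (μ := volume) a b
  have hW := zeroMeanAntideriv_continuous hAi
  have hWper := zeroMeanAntideriv_periodic hAi (zeroMeanAntideriv_periodic hU1 hper hmean)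
    (zeroMeanAntideriv_integral hU1)
  constructor
  · rintro ⟨V, hV, hVper, hode, hUV⟩ v hv hvper hvmean
    have hVmean : (∫ z in (0:ℝ)..(2 * π), V z) = 0 :=
      (intervalIntegral.integral_congr_ae (hUV.mono fun z hz _ => hz.symm)).trans hmean
    obtain ⟨c, hc⟩ := gradSfun_eq_const_of_ode hV hVper hVmean hode
    refine (hderiv v hv hvper hvmean).congr_deriv ?_
    have : (∫ z in (0:ℝ)..(2 * π), gradSfun γ U z * v z) = ∫ z in (0:ℝ)..(2 * π), c * v z :=
      intervalIntegral.integral_congr_ae <| hUV.mono fun z hz _ => by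
        rw [← hc z, gradSfun, gradSfun, hz, zeroMeanAntideriv_congr_ae hUV]
    rw [this, intervalIntegral.integral_const_mul, hvmean, mul_zero]
  · intro hcrit
    obtain ⟨c, hc⟩ := exists_ae_eq_const_of_integral_mul_periodic_eq_zero hP
      (gradSfun_intervalIntegrable γ hU1 (hUpow 2) _ _)
      fun v hv hvper hvmean => (hderiv v hv hvper hvmean).unique (hcrit v hv hvper hvmean)
    have hgrad : ∀ᵐ z ∂(volume : Measure ℝ), gradSfun γ U z = c :=
      ae_of_periodic_of_ae_Ioo hP (fun z => by simp only [gradSfun, hper z, hWper z]) hc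
    set G : ℝ → ℝ := fun z => γ ^ 2 + c + 2 * zeroMeanAntideriv (zeroMeanAntideriv U) z with hG
    have hGc : Continuous G := continuous_const.add (continuous_const.mul hW)
    have hUG : ∀ᵐ z ∂(volume : Measure ℝ), (γ - U z) ^ 2 = G z := by
      filter_upwards [hgrad] with z hz
      rw [hG, ← hz, gradSfun]
      ring
    have hpos (z : ℝ) : 0 < G z := by
      refine (pow_pos hδ 2).trans_le (hGc.forall_le_of_ae_le ?_ z)
      filter_upwards [hUG, hlt] with z hz hz'
      rw [← hz]
      exact pow_le_pow_left₀ hδ.le (by linarith) 2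
    set V : ℝ → ℝ := fun z => γ - √(G z) with hVdef
    have hVc : Continuous V := continuous_const.sub hGc.sqrt
    have hUV : ∀ᵐ z ∂(volume : Measure ℝ), U z = V z := by
      filter_upwards [hUG, hlt] with z hz hz'
      rw [hVdef]
      simp only [← hz]
      rw [Real.sqrt_sq (by linarith)]
      ring
    have hGV (z : ℝ) : G z = γ ^ 2 + c + 2 * zeroMeanAntideriv (zeroMeanAntideriv V) z := by
      rw [← zeroMeanAntideriv_congr_ae hUV]
    exact ⟨V, contDiff_of_eq_sub_sqrt hVc hGV hpos fun _ => rfl,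
      fun z => by simp only [hVdef, hG, hWper z],
      ode_of_eq_sub_sqrt hVc hGV hpos fun _ => rfl, hUV⟩
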